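/- Let d ≥ 1, p,q ∈ (1,∞) and 0 ≤ β' < β. If f ∈ E_{p,q,β'} (i.e. f is locally L_{p,q} with finite parabolic Morrey norm ‖f‖_{E_{p,q,β'}}), then for every parabolic cylinder C = C_R(t₀,x₀) (any R > 0) one has lim_{ε↓0} ‖(f^{(ε)} − f)·1_C‖_{E_{p,q,β}} = 0. -/

import Mathlib

open MeasureTheory ENNReal NNReal Metric Set Filter Topology

noncomputable section

/-- Euclidean space `ℝ^d`. -/
abbrev Spc (d : ℕ) : Type := EuclideanSpace ℝ (Fin d)

/-- Space-time `ℝ^{d+1} = ℝ × ℝ^d`, a point is `(t, x)`. -/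
abbrev SpT (d : ℕ) : Type := ℝ × Spc d

/-- The parabolic cylinder `C_ρ(t₀,x₀) = [t₀, t₀+ρ²) × B_ρ(x₀)`. -/
def pCyl (d : ℕ) (ρ t₀ : ℝ) (x₀ : Spc d) : Set (SpT d) :=
  (Set.Ico t₀ (t₀ + ρ ^ 2)) ×ˢ (Metric.ball x₀ ρ)

/-- The (unnormalized) norm `‖f‖_{L_{p,q}(A)}
    = (∫_ℝ (∫_{ℝ^d} |f(t,x)|^p 1_A(t,x) dx)^{q/p} dt)^{1/q}`. -/
def lpqNorm (d : ℕ) (p q : ℝ) (f : SpT d → ℝ) (A : Set (SpT d)) : ℝ≥0∞ :=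
  (∫⁻ t : ℝ, (∫⁻ x : Spc d, A.indicator (fun z => ENNReal.ofReal |f z| ^ p) (t, x)) ^ (q / p)) ^ (1 / q)

/-- The normalized norm `⨍‖f‖_{L_{p,q}(C)}` over the cylinder `C_ρ(t₀,x₀)`:
    inner integral replaced by the average over the spatial ball, outer one
    by the average over the time interval. -/
def avgLpq (d : ℕ) (p q ρ t₀ : ℝ) (x₀ : Spc d) (f : SpT d → ℝ) : ℝ≥0∞ :=
  ((∫⁻ t in Set.Ico t₀ (t₀ + ρ ^ 2),
      ((∫⁻ x in Metric.ball x₀ ρ, ENNReal.ofReal |f (t, x)| ^ p) / volume (Metric.ball x₀ ρ)) ^ (q / p))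
      / ENNReal.ofReal (ρ ^ 2)) ^ (1 / q)

/-- The parabolic Morrey norm `‖f‖_{E_{p,q,β}}
    = sup { ρ^β ⨍‖f‖_{L_{p,q}(C)} : 0 < ρ ≤ 1, C ∈ ℂ_ρ }`. -/
def morreyNorm (d : ℕ) (p q β : ℝ) (f : SpT d → ℝ) : ℝ≥0∞ :=
  ⨆ (ρ : ℝ) (_ : 0 < ρ) (_ : ρ ≤ 1) (t₀ : ℝ) (x₀ : Spc d),
    ENNReal.ofReal (ρ ^ β) * avgLpq d p q ρ t₀ x₀ f

/-- The homogeneous parabolic Morrey norm `‖f‖_{Ė_{p,q,β}}` (all radii `ρ > 0`). -/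
def morreyNormH (d : ℕ) (p q β : ℝ) (f : SpT d → ℝ) : ℝ≥0∞ :=
  ⨆ (ρ : ℝ) (_ : 0 < ρ) (t₀ : ℝ) (x₀ : Spc d),
    ENNReal.ofReal (ρ ^ β) * avgLpq d p q ρ t₀ x₀ f

/-- Membership `f ∈ E_{p,q,β}`. -/
def MemE (d : ℕ) (p q β : ℝ) (f : SpT d → ℝ) : Prop :=
  AEStronglyMeasurable f volume ∧ morreyNorm d p q β f ≠ ⊤

/-- Membership `f ∈ Ė_{p,q,β}` (homogeneous). -/
def MemEH (d : ℕ) (p q β : ℝ) (f : SpT d → ℝ) : Prop :=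
  AEStronglyMeasurable f volume ∧ morreyNormH d p q β f ≠ ⊤

/-- The elliptic Morrey norm `‖f‖_{E_{p,β}(ℝ^d)}
    = sup { ρ^β (⨍_{B_ρ(x)} |f|^p)^{1/p} : 0 < ρ ≤ 1, x ∈ ℝ^d }`. -/
def morreyNormE (d : ℕ) (p β : ℝ) (f : Spc d → ℝ) : ℝ≥0∞ :=
  ⨆ (ρ : ℝ) (_ : 0 < ρ) (_ : ρ ≤ 1) (x₀ : Spc d),
    ENNReal.ofReal (ρ ^ β) *
      ((∫⁻ y in Metric.ball x₀ ρ, ENNReal.ofReal |f y| ^ p) / volume (Metric.ball x₀ ρ)) ^ (1 / p)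

/-- The homogeneous elliptic Morrey norm on `ℝ^d` (all radii `ρ > 0`). -/
def morreyNormEH (d : ℕ) (p β : ℝ) (f : Spc d → ℝ) : ℝ≥0∞ :=
  ⨆ (ρ : ℝ) (_ : 0 < ρ) (x₀ : Spc d),
    ENNReal.ofReal (ρ ^ β) *
      ((∫⁻ y in Metric.ball x₀ ρ, ENNReal.ofReal |f y| ^ p) / volume (Metric.ball x₀ ρ)) ^ (1 / p)

/-- A mollifying kernel: nonnegative, smooth, compactly supported in
    `[-1,0) × B_1(0)`, with unit integral. -/
def IsMollifier (d : ℕ) (ζ : SpT d → ℝ) : Prop :=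
  ContDiff ℝ (⊤ : ℕ∞) ζ ∧ (∀ z, 0 ≤ ζ z) ∧ (∫ z, ζ z) = 1 ∧
    Function.support ζ ⊆ (Set.Ico (-1 : ℝ) 0) ×ˢ (Metric.ball (0 : Spc d) 1)

/-- The mollification `f^{(ε)} = f * ζ_ε`, where
    `ζ_ε(t,x) = ε^{-d-2} ζ(t/ε², x/ε)`. -/
def mollify (d : ℕ) (ζ : SpT d → ℝ) (ε : ℝ) (f : SpT d → ℝ) (z : SpT d) : ℝ :=
  ∫ w : SpT d, (ε ^ (-(d : ℝ) - 2) * ζ (w.1 / ε ^ 2, ε⁻¹ • w.2)) * f (z.1 - w.1, z.2 - w.2)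

/-- The time direction in space-time. -/
def dirT (d : ℕ) : SpT d := (1, 0)

/-- The `i`-th spatial direction in space-time. -/
def dirS (d : ℕ) (i : Fin d) : SpT d := (0, EuclideanSpace.single i 1)

/-- `v` is the weak derivative of `u` in the direction `e`. -/
def IsWeakDeriv (d : ℕ) (u v : SpT d → ℝ) (e : SpT d) : Prop :=
  ∀ φ : SpT d → ℝ, ContDiff ℝ (⊤ : ℕ∞) φ → HasCompactSupport φ →
    ∫ z, u z * fderiv ℝ φ z e = - ∫ z, v z * φ z

/-- `v` is the second weak derivative of `u` in the directions `e₁, e₂`. -/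
def IsWeakDeriv2 (d : ℕ) (u v : SpT d → ℝ) (e₁ e₂ : SpT d) : Prop :=
  ∀ φ : SpT d → ℝ, ContDiff ℝ (⊤ : ℕ∞) φ → HasCompactSupport φ →
    ∫ z, u z * fderiv ℝ (fun w => fderiv ℝ φ w e₁) z e₂ = ∫ z, v z * φ z

/-- The magnitude `|Du|` of the spatial gradient. -/
def gradMag (d : ℕ) (Du : Fin d → SpT d → ℝ) (z : SpT d) : ℝ :=
  Real.sqrt (∑ i, (Du i z) ^ 2)

/-- The magnitude `|D²u|` of the spatial Hessian. -/
def hessMag (d : ℕ) (D2u : Fin d → Fin d → SpT d → ℝ) (z : SpT d) : ℝ :=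
  Real.sqrt (∑ i, ∑ j, (D2u i j z) ^ 2)

/-- `u ∈ E^{1,2}_{p,q,β}`, with weak spatial gradient `Du`, weak spatial Hessian
    `D2u`, and weak time derivative `ut`, all in `E_{p,q,β}`. -/
def Mem12 (d : ℕ) (p q β : ℝ) (u : SpT d → ℝ) (Du : Fin d → SpT d → ℝ)
    (D2u : Fin d → Fin d → SpT d → ℝ) (ut : SpT d → ℝ) : Prop :=
  MemE d p q β u ∧ (∀ i, IsWeakDeriv d u (Du i) (dirS d i)) ∧
    (∀ i j, IsWeakDeriv2 d u (D2u i j) (dirS d i) (dirS d j)) ∧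
    IsWeakDeriv d u ut (dirT d) ∧
    (∀ i, MemE d p q β (Du i)) ∧ (∀ i j, MemE d p q β (D2u i j)) ∧ MemE d p q β ut

/-- `u ∈ Ė^{1,2}_{p,q,β}` (homogeneous version). -/
def Mem12H (d : ℕ) (p q β : ℝ) (u : SpT d → ℝ) (Du : Fin d → SpT d → ℝ)
    (D2u : Fin d → Fin d → SpT d → ℝ) (ut : SpT d → ℝ) : Prop :=
  MemEH d p q β u ∧ (∀ i, IsWeakDeriv d u (Du i) (dirS d i)) ∧
    (∀ i j, IsWeakDeriv2 d u (D2u i j) (dirS d i) (dirS d j)) ∧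
    IsWeakDeriv d u ut (dirT d) ∧
    (∀ i, MemEH d p q β (Du i)) ∧ (∀ i j, MemEH d p q β (D2u i j)) ∧ MemEH d p q β ut

/-- The norm `‖u‖_{E^{1,2}_{p,q,β}} = ‖u‖ + ‖Du‖ + ‖D²u‖ + ‖∂ₜu‖`. -/
def norm12 (d : ℕ) (p q β : ℝ) (u : SpT d → ℝ) (Du : Fin d → SpT d → ℝ)
    (D2u : Fin d → Fin d → SpT d → ℝ) (ut : SpT d → ℝ) : ℝ≥0∞ :=
  morreyNorm d p q β u + morreyNorm d p q β (gradMag d Du)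
    + morreyNorm d p q β (hessMag d D2u) + morreyNorm d p q β ut

/-- Membership `f ∈ L_{p,q}(ℝ^{d+1})`. -/
def MemLpq (d : ℕ) (p q : ℝ) (f : SpT d → ℝ) : Prop :=
  AEStronglyMeasurable f volume ∧ lpqNorm d p q f Set.univ ≠ ⊤

/-- `u ∈ W^{1,2}_{p,q}(ℝ^{d+1})`: `u`, its weak spatial gradient `Du`,
    weak spatial Hessian `D2u` and weak time derivative `ut` are in `L_{p,q}`. -/
def MemW12 (d : ℕ) (p q : ℝ) (u : SpT d → ℝ) (Du : Fin d → SpT d → ℝ)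
    (D2u : Fin d → Fin d → SpT d → ℝ) (ut : SpT d → ℝ) : Prop :=
  MemLpq d p q u ∧ (∀ i, IsWeakDeriv d u (Du i) (dirS d i)) ∧
    (∀ i j, IsWeakDeriv2 d u (D2u i j) (dirS d i) (dirS d j)) ∧
    IsWeakDeriv d u ut (dirT d) ∧
    (∀ i, MemLpq d p q (Du i)) ∧ (∀ i j, MemLpq d p q (D2u i j)) ∧ MemLpq d p q ut

/-- Convergence `F ε → v` in `L_r(B)` as `ε ↓ 0`. -/
def TendstoLr (d : ℕ) (r : ℝ) (B : Set (Spc d)) (F : ℝ → Spc d → ℝ) (v : Spc d → ℝ) : Prop :=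
  Tendsto (fun ε => (∫⁻ x in B, ENNReal.ofReal |F ε x - v x| ^ r) ^ (1 / r))
    (𝓝[>] (0 : ℝ)) (𝓝 0)

/-- **Minkowski's integral inequality** for `ℝ≥0∞`-valued kernels. -/
theorem lintegral_rpow_lintegral_le {α γ : Type*} [MeasurableSpace α] [MeasurableSpace γ]
    (μ : Measure α) [SigmaFinite μ] (ν : Measure γ) [SFinite ν] {p : ℝ} (hp : 1 < p)
    {K : α → γ → ℝ≥0∞} (hK : Measurable (Function.uncurry K)) :
    (∫⁻ x, (∫⁻ y, K x y ∂ν) ^ p ∂μ) ^ (1 / p) ≤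
      ∫⁻ y, (∫⁻ x, K x y ^ p ∂μ) ^ (1 / p) ∂ν := by
  classical
  have hp0 : 0 < p := by linarith
  set M := ∫⁻ y, (∫⁻ x, K x y ^ p ∂μ) ^ (1 / p) ∂ν with hM
  set G : α → ℝ≥0∞ := fun x => ∫⁻ y, K x y ∂ν with hG
  have hGm : Measurable G := hK.lintegral_prod_right'
  set g : ℕ → α → ℝ≥0∞ := fun n => (spanningSets μ n).indicator (fun x => min (G x) n) with hg
  have hgm : ∀ n, Measurable (g n) := fun n =>
    (hGm.min measurable_const).indicator (measurableSet_spanningSets μ n)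
  have hgG : ∀ n x, g n x ≤ G x := fun n x => by
    simp only [hg, indicator_apply]; split_ifs <;> simp
  have hgmono : Monotone g := by
    intro n m hnm x
    simp only [hg, indicator_apply]
    by_cases h : x ∈ spanningSets μ n
    · rw [if_pos h, if_pos (monotone_spanningSets μ hnm h)]
      exact min_le_min le_rfl (by exact_mod_cast hnm)
    · simp [h]
  have hsup : ∀ x, ⨆ n, g n x = G x := by
    intro x
    refine le_antisymm (iSup_le fun n => hgG n x) ?_
    refine le_of_forall_lt fun c hc => ?_
    obtain ⟨k, hk⟩ := ENNReal.exists_nat_gt (ne_top_of_lt hc)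
    have hx := mem_spanningSetsIndex μ x
    set n := max k (spanningSetsIndex μ x)
    have h1 : x ∈ spanningSets μ n := monotone_spanningSets μ (le_max_right _ _) hx
    refine lt_of_lt_of_le ?_ (le_iSup _ n)
    simp only [hg, indicator_of_mem h1]
    refine lt_min hc (hk.trans_le ?_)
    exact_mod_cast le_max_left _ _
  have hbound : ∀ n, ∫⁻ x, g n x ^ p ∂μ ≤ M ^ p := by
    intro n
    set A := ∫⁻ x, g n x ^ p ∂μ with hA
    have hAtop : A ≠ ∞ := by
      have : A ≤ ∫⁻ x, (spanningSets μ n).indicator (fun _ => (n : ℝ≥0∞) ^ p) x ∂μ := by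
        refine lintegral_mono fun x => ?_
        simp only [hg, indicator_apply]
        split_ifs
        · gcongr; exact min_le_right _ _
        · simp [hp0]
      refine ne_top_of_le_ne_top ?_ this
      rw [lintegral_indicator (measurableSet_spanningSets μ n), setLIntegral_const]
      exact ENNReal.mul_ne_top (ENNReal.rpow_ne_top_of_nonneg hp0.le (by simp))
        (measure_spanningSets_lt_top μ n).ne
    have hpq := Real.HolderConjugate.conjExponent hp
    set p' := p.conjExponent
    have key : A ≤ A ^ (1 / p') * M := by
      calc A = ∫⁻ x, g n x ^ (p - 1) * g n x ∂μ := by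
            refine lintegral_congr fun x => ?_
            rcases eq_or_ne (g n x) 0 with h0 | h0
            · simp [h0, hp0]
            · have : g n x ≠ ∞ := by
                refine ne_top_of_le_ne_top (ENNReal.natCast_ne_top n) ?_
                simp only [hg, indicator_apply]
                split_ifs <;> simp
              nth_rewrite 3 [← ENNReal.rpow_one (g n x)]
              rw [← ENNReal.rpow_add _ _ h0 this]; simp
        _ ≤ ∫⁻ x, g n x ^ (p - 1) * G x ∂μ := by
            gcongr with x; exact hgG n x
        _ = ∫⁻ x, ∫⁻ y, g n x ^ (p - 1) * K x y ∂ν ∂μ := by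
            refine lintegral_congr fun x => ?_
            exact (lintegral_const_mul _ (hK.comp measurable_prodMk_left)).symm
        _ = ∫⁻ y, ∫⁻ x, g n x ^ (p - 1) * K x y ∂μ ∂ν := by
            refine lintegral_lintegral_swap ?_
            exact ((((hgm n).pow_const _).comp measurable_fst).mul hK).aemeasurable
        _ ≤ ∫⁻ y, A ^ (1 / p') * (∫⁻ x, K x y ^ p ∂μ) ^ (1 / p) ∂ν := by
            refine lintegral_mono fun y => ?_
            refine (ENNReal.lintegral_mul_le_Lp_mul_Lq μ hpq.symm
              ((hgm n).pow_const (p - 1)).aemeasurable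
              (hK.comp measurable_prodMk_right).aemeasurable).trans (le_of_eq ?_)
            congr 2
            refine lintegral_congr fun x => ?_
            rw [← ENNReal.rpow_mul, hpq.sub_one_mul_conj]
        _ = A ^ (1 / p') * M := by
            rw [lintegral_const_mul]
            exact Measurable.pow_const
              (Measurable.lintegral_prod_right' (f := fun z : γ × α => K z.2 z.1 ^ p)
                ((hK.comp measurable_swap).pow_const p)) _
    rcases eq_or_ne A 0 with h0 | h0
    · simp [h0]
    have hs : A = A ^ (1 / p') * A ^ (1 / p) := by
      rw [← ENNReal.rpow_add _ _ h0 hAtop]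
      have := hpq.inv_add_inv_eq_one
      rw [show 1 / p' + 1 / p = 1 by simpa [add_comm] using this, ENNReal.rpow_one]
    have hle : A ^ (1 / p) ≤ M := by
      have h1 : A ^ (1 / p') ≠ 0 := by simp [h0, hAtop]
      have h2 : A ^ (1 / p') ≠ ∞ :=
        ENNReal.rpow_ne_top_of_nonneg (by simpa using hpq.symm.nonneg) hAtop
      exact (ENNReal.mul_le_mul_iff_right h1 h2).1 (hs.symm.trans_le key)
    calc A = (A ^ (1 / p)) ^ p := by rw [← ENNReal.rpow_mul]; simp [hp0.ne']
      _ ≤ M ^ p := by gcongr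
  have hfin : ∫⁻ x, G x ^ p ∂μ ≤ M ^ p := by
    calc ∫⁻ x, G x ^ p ∂μ = ∫⁻ x, ⨆ n, g n x ^ p ∂μ := by
          refine lintegral_congr fun x => ?_
          rw [← hsup x]
          exact (ENNReal.orderIsoRpow p hp0).map_iSup _
      _ = ⨆ n, ∫⁻ x, g n x ^ p ∂μ :=
          lintegral_iSup (fun n => (hgm n).pow_const p)
            (fun n m h x => ENNReal.rpow_le_rpow (hgmono h x) hp0.le)
      _ ≤ M ^ p := iSup_le hbound
  calc (∫⁻ x, G x ^ p ∂μ) ^ (1 / p) ≤ (M ^ p) ^ (1 / p) := by gcongr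
    _ = M := by rw [← ENNReal.rpow_mul]; simp [hp0.ne']

/-- The mixed norm `‖F‖_{L_{p,q}}` on space-time of a function with values in `ℝ≥0∞`. -/
def mixedNorm (d : ℕ) (p q : ℝ) (F : SpT d → ℝ≥0∞) : ℝ≥0∞ :=
  (∫⁻ t : ℝ, ((∫⁻ x : Spc d, F (t, x) ^ p) ^ (1 / p)) ^ q) ^ (1 / q)

section MixedNorm

variable {d : ℕ} {p q : ℝ} {F G : SpT d → ℝ≥0∞}

theorem mixedNorm_mono (hp : 0 < p) (hq : 0 < q) (h : ∀ z, F z ≤ G z) :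
    mixedNorm d p q F ≤ mixedNorm d p q G := by
  unfold mixedNorm
  gcongr
  exact h _

theorem mixedNorm_congr_ae (h : F =ᵐ[volume] G) : mixedNorm d p q F = mixedNorm d p q G := by
  unfold mixedNorm
  congr 1
  refine lintegral_congr_ae ?_
  filter_upwards [Measure.ae_ae_of_ae_prod h] with t ht
  congr 2
  refine lintegral_congr_ae ?_
  filter_upwards [ht] with x hx
  rw [hx]

theorem measurable_inner_norm (hF : Measurable F) :
    Measurable fun t : ℝ => (∫⁻ x : Spc d, F (t, x) ^ p) ^ (1 / p) :=
  (Measurable.lintegral_prod_right' (hF.pow_const p)).pow_const _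

theorem mixedNorm_add_le (hp : 1 ≤ p) (hq : 1 ≤ q) (hF : Measurable F) (hG : Measurable G) :
    mixedNorm d p q (fun z => F z + G z) ≤ mixedNorm d p q F + mixedNorm d p q G := by
  unfold mixedNorm
  refine le_trans ?_ (ENNReal.lintegral_Lp_add_le (measurable_inner_norm hF).aemeasurable
    (measurable_inner_norm hG).aemeasurable hq)
  gcongr with t
  exact ENNReal.lintegral_Lp_add_le (hF.comp measurable_prodMk_left).aemeasurable
    (hG.comp measurable_prodMk_left).aemeasurable hp

/-- Minkowski's integral inequality for the mixed norm. -/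
theorem mixedNorm_lintegral_le {γ : Type*} [MeasurableSpace γ] (ν : Measure γ) [SFinite ν]
    (hp : 1 < p) (hq : 1 < q) {K : SpT d → γ → ℝ≥0∞} (hK : Measurable (Function.uncurry K)) :
    mixedNorm d p q (fun z => ∫⁻ w, K z w ∂ν) ≤ ∫⁻ w, mixedNorm d p q (fun z => K z w) ∂ν := by
  unfold mixedNorm
  have hm : Measurable (Function.uncurry fun (t : ℝ) (w : γ) =>
      (∫⁻ x : Spc d, K (t, x) w ^ p) ^ (1 / p)) := by
    refine Measurable.pow_const ?_ _
    refine Measurable.lintegral_prod_right'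
      (f := fun u : (ℝ × γ) × Spc d => K (u.1.1, u.2) u.1.2 ^ p) ?_
    exact (hK.comp (f := fun u : (ℝ × γ) × Spc d => ((u.1.1, u.2), u.1.2))
      (by fun_prop)).pow_const p
  refine le_trans ?_ (lintegral_rpow_lintegral_le volume ν hq hm)
  gcongr with t
  exact lintegral_rpow_lintegral_le volume ν hp (K := fun x w => K (t, x) w)
    (hK.comp (f := fun u : Spc d × γ => ((t, u.1), u.2)) (by fun_prop))

theorem mixedNorm_translate (F : SpT d → ℝ≥0∞) (w : SpT d) :
    mixedNorm d p q (fun z => F (z - w)) = mixedNorm d p q F := by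
  unfold mixedNorm
  congr 1
  rw [← lintegral_sub_right_eq_self
    (fun t => ((∫⁻ x : Spc d, F (t, x) ^ p) ^ (1 / p)) ^ q) w.1]
  refine lintegral_congr fun t => ?_
  rw [← lintegral_sub_right_eq_self (fun x => F (t - w.1, x) ^ p) w.2]
  rfl

theorem mixedNorm_indicator_prod (hp : 0 < p) (hq : 0 < q) {I : Set ℝ} {B : Set (Spc d)}
    (hI : MeasurableSet I) (hB : MeasurableSet B) (F : SpT d → ℝ≥0∞) :
    mixedNorm d p q ((I ×ˢ B).indicator F) =
      (∫⁻ t in I, ((∫⁻ x in B, F (t, x) ^ p) ^ (1 / p)) ^ q) ^ (1 / q) := by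
  unfold mixedNorm
  congr 1
  rw [← lintegral_indicator hI]
  refine lintegral_congr fun t => ?_
  by_cases ht : t ∈ I
  · rw [indicator_of_mem ht, ← lintegral_indicator hB]
    congr 2
    refine lintegral_congr fun x => ?_
    by_cases hx : x ∈ B
    · rw [indicator_of_mem hx, indicator_of_mem (mk_mem_prod ht hx)]
    · rw [indicator_of_notMem hx, indicator_of_notMem (fun h => hx h.2), ENNReal.zero_rpow_of_pos hp]
  · rw [indicator_of_notMem ht]
    have : ∀ x, (I ×ˢ B).indicator F (t, x) = 0 := fun x =>
      indicator_of_notMem (fun h => ht h.1) _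
    simp [this, hp, hq]

/-- The normalizing factor between `L_{p,q}(C)` and its averaged version when `C` has radius `ρ`. -/
def cylConst (d : ℕ) (p q ρ : ℝ) : ℝ≥0∞ :=
  ((volume (ball (0 : Spc d) ρ))⁻¹) ^ (1 / p) * ((ENNReal.ofReal (ρ ^ 2))⁻¹) ^ (1 / q)

theorem cylConst_ne_top (hp : 0 < p) (hq : 0 < q) {ρ : ℝ} (hρ : 0 < ρ) :
    cylConst d p q ρ ≠ ∞ := by
  refine ENNReal.mul_ne_top (ENNReal.rpow_ne_top_of_nonneg (by positivity) ?_)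
    (ENNReal.rpow_ne_top_of_nonneg (by positivity) ?_)
  · exact ENNReal.inv_ne_top.2 (measure_ball_pos _ _ hρ).ne'
  · exact ENNReal.inv_ne_top.2 (by simpa using hρ.ne')

theorem cylConst_anti (hp : 0 < p) (hq : 0 < q) {δ ρ : ℝ} (hδ : 0 < δ) (h : δ ≤ ρ) :
    cylConst d p q ρ ≤ cylConst d p q δ := by
  unfold cylConst
  gcongr

theorem cylConst_ne_zero (hp : 0 < p) (hq : 0 < q) {ρ : ℝ} :
    cylConst d p q ρ ≠ 0 := by
  unfold cylConst
  have h1 : (volume (ball (0 : Spc d) ρ))⁻¹ ≠ 0 := ENNReal.inv_ne_zero.2 measure_ball_lt_top.ne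
  have h2 : (ENNReal.ofReal (ρ ^ 2))⁻¹ ≠ 0 := ENNReal.inv_ne_zero.2 ENNReal.ofReal_ne_top
  simp [h1, h2, hp.le, hq.le, ENNReal.rpow_eq_zero_iff, not_lt.2, hp, hq]

theorem measurableSet_pCyl (ρ t₀ : ℝ) (x₀ : Spc d) : MeasurableSet (pCyl d ρ t₀ x₀) :=
  measurableSet_Ico.prod measurableSet_ball

theorem avgLpq_eq (hp : 0 < p) (hq : 0 < q) {ρ : ℝ} (hρ : 0 < ρ) (t₀ : ℝ) (x₀ : Spc d)
    (f : SpT d → ℝ) :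
    avgLpq d p q ρ t₀ x₀ f =
      cylConst d p q ρ * mixedNorm d p q ((pCyl d ρ t₀ x₀).indicator fun z => ‖f z‖ₑ) := by
  have hV : (volume (ball (0 : Spc d) ρ))⁻¹ ≠ ∞ :=
    ENNReal.inv_ne_top.2 (measure_ball_pos _ _ hρ).ne'
  have hVx : volume (ball x₀ ρ) = volume (ball (0 : Spc d) ρ) := by
    rw [Measure.addHaar_ball_center]
  unfold pCyl avgLpq cylConst
  rw [mixedNorm_indicator_prod hp hq measurableSet_Ico measurableSet_ball, hVx]
  set V := (volume (ball (0 : Spc d) ρ))⁻¹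
  have h1 : ∀ t, ((∫⁻ x in ball x₀ ρ, ENNReal.ofReal |f (t, x)| ^ p) /
      volume (ball (0 : Spc d) ρ)) ^ (q / p) =
      (V ^ (1 / p)) ^ q * ((∫⁻ x in ball x₀ ρ, ‖f (t, x)‖ₑ ^ p) ^ (1 / p)) ^ q := by
    intro t
    rw [ENNReal.div_eq_inv_mul, ENNReal.mul_rpow_of_nonneg _ _ (by positivity)]
    simp only [← Real.norm_eq_abs, ofReal_norm, ← ENNReal.rpow_mul]
    congr 2 <;> ring_nf
  simp only [h1]
  rw [lintegral_const_mul' _ _ (ENNReal.rpow_ne_top_of_nonneg hq.le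
    (ENNReal.rpow_ne_top_of_nonneg (by positivity) hV)), ENNReal.div_eq_inv_mul,
    ENNReal.mul_rpow_of_nonneg _ _ (by positivity), ENNReal.mul_rpow_of_nonneg _ _ (by positivity),
    ← ENNReal.rpow_mul (V ^ (1 / p)), mul_one_div_cancel hq.ne', ENNReal.rpow_one]
  ring

theorem le_morreyNorm (hp : 0 < p) (hq : 0 < q) (β : ℝ) (f : SpT d → ℝ) {ρ : ℝ} (hρ : 0 < ρ)
    (hρ1 : ρ ≤ 1) (t₀ : ℝ) (x₀ : Spc d) :
    ENNReal.ofReal (ρ ^ β) * (cylConst d p q ρ *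
      mixedNorm d p q ((pCyl d ρ t₀ x₀).indicator fun z => ‖f z‖ₑ)) ≤ morreyNorm d p q β f := by
  rw [← avgLpq_eq hp hq hρ]
  unfold morreyNorm
  exact le_iSup_of_le ρ <| le_iSup_of_le hρ <| le_iSup_of_le hρ1 <| le_iSup_of_le t₀ <|
    le_iSup_of_le x₀ le_rfl

theorem morreyNorm_le (hp : 0 < p) (hq : 0 < q) {β : ℝ} {f : SpT d → ℝ} {A : ℝ≥0∞}
    (h : ∀ ρ : ℝ, 0 < ρ → ρ ≤ 1 → ∀ (t₀ : ℝ) (x₀ : Spc d), ENNReal.ofReal (ρ ^ β) *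
      (cylConst d p q ρ * mixedNorm d p q ((pCyl d ρ t₀ x₀).indicator fun z => ‖f z‖ₑ)) ≤ A) :
    morreyNorm d p q β f ≤ A := by
  unfold morreyNorm
  refine iSup_le fun ρ => iSup_le fun hρ => iSup_le fun hρ1 => iSup_le fun t₀ => iSup_le fun x₀ => ?_
  rw [avgLpq_eq hp hq hρ]
  exact h ρ hρ hρ1 t₀ x₀

theorem morreyNorm_congr_ae (hp : 0 < p) (hq : 0 < q) {β : ℝ} {f g : SpT d → ℝ}
    (h : f =ᵐ[volume] g) : morreyNorm d p q β f = morreyNorm d p q β g := by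
  have aux : ∀ f g : SpT d → ℝ, f =ᵐ[volume] g → morreyNorm d p q β f ≤ morreyNorm d p q β g := by
    intro f g h
    refine morreyNorm_le hp hq fun ρ hρ hρ1 t₀ x₀ => ?_
    refine le_trans (le_of_eq ?_) (le_morreyNorm hp hq β g hρ hρ1 t₀ x₀)
    congr 2
    refine mixedNorm_congr_ae ?_
    filter_upwards [h] with z hz
    simp only [indicator, hz]
  exact le_antisymm (aux f g h) (aux g f h.symm)

end MixedNorm

section Approximation

variable {d : ℕ} {p q : ℝ}

theorem mixedNorm_indicator_ne_top_of_isCompact (hp : 1 < p) (hq : 1 < q) {β : ℝ}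
    {f : SpT d → ℝ} (hf : Measurable f) (hfin : morreyNorm d p q β f ≠ ∞)
    {K : Set (SpT d)} (hK : IsCompact K) :
    mixedNorm d p q (K.indicator fun z => ‖f z‖ₑ) ≠ ∞ := by
  have hp0 : 0 < p := by linarith
  have hq0 : 0 < q := by linarith
  have key : ∃ T, MeasurableSet T ∧ K ⊆ T ∧
      mixedNorm d p q (T.indicator fun z => ‖f z‖ₑ) ≠ ∞ := by
    refine hK.induction_on
      (p := fun S => ∃ T, MeasurableSet T ∧ S ⊆ T ∧
        mixedNorm d p q (T.indicator fun z => ‖f z‖ₑ) ≠ ∞) ?_ ?_ ?_ ?_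
    · refine ⟨∅, MeasurableSet.empty, le_rfl, ?_⟩
      simp [mixedNorm, hp0, hq0]
    · rintro S S' h ⟨T, hT, hST, hfT⟩
      exact ⟨T, hT, h.trans hST, hfT⟩
    · rintro S S' ⟨T, hT, hST, hfT⟩ ⟨T', hT', hST', hfT'⟩
      refine ⟨T ∪ T', hT.union hT', union_subset_union hST hST', ?_⟩
      refine ne_top_of_le_ne_top (ENNReal.add_ne_top.2 ⟨hfT, hfT'⟩)
        (le_trans (mixedNorm_mono hp0 hq0 fun z => ?_)
          (mixedNorm_add_le hp.le hq.le (hf.enorm.indicator hT) (hf.enorm.indicator hT')))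
      by_cases h : z ∈ T <;> by_cases h' : z ∈ T' <;> simp [h, h']
    · rintro ⟨t, x⟩ -
      refine ⟨pCyl d 1 (t - 1 / 2) x, mem_nhdsWithin_of_mem_nhds ?_, pCyl d 1 (t - 1 / 2) x,
        measurableSet_pCyl _ _ _, le_rfl, ?_⟩
      · exact prod_mem_nhds (Ico_mem_nhds (by linarith) (by linarith)) (ball_mem_nhds _ one_pos)
      · have h := le_morreyNorm hp0 hq0 β f one_pos le_rfl (t - 1 / 2) x
        intro htop
        rw [htop, ENNReal.mul_top (cylConst_ne_zero hp0 hq0)] at h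
        simp at h
        exact hfin h
  obtain ⟨T, -, hKT, hT⟩ := key
  exact ne_top_of_le_ne_top hT
    (mixedNorm_mono hp0 hq0 fun z => indicator_le_indicator_of_subset hKT (fun _ => zero_le) z)

theorem tendsto_mixedNorm_of_dominated (hp : 0 < p) (hq : 0 < q) {F : ℕ → SpT d → ℝ≥0∞}
    {G : SpT d → ℝ≥0∞} (hF : ∀ n, Measurable (F n)) (hG : Measurable G)
    (hFG : ∀ n z, F n z ≤ G z) (hfin : mixedNorm d p q G ≠ ∞)
    (hlim : ∀ z, Tendsto (fun n => F n z) atTop (𝓝 0)) :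
    Tendsto (fun n => mixedNorm d p q (F n)) atTop (𝓝 0) := by
  have hG1 : ∫⁻ t : ℝ, ((∫⁻ x : Spc d, G (t, x) ^ p) ^ (1 / p)) ^ q ≠ ∞ := by
    intro h
    apply hfin
    rw [mixedNorm, h, ENNReal.top_rpow_of_pos (by positivity)]
  have hG2 : ∀ᵐ t : ℝ, ∫⁻ x : Spc d, G (t, x) ^ p ≠ ∞ := by
    filter_upwards [ae_lt_top ((measurable_inner_norm hG).pow_const q) hG1] with t ht h
    simp [h, hp, hq] at ht
  have hpow : ∀ {s : ℝ}, 0 < s → ∀ {u : ℕ → ℝ≥0∞}, Tendsto u atTop (𝓝 0) →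
      Tendsto (fun n => u n ^ s) atTop (𝓝 0) := by
    intro s hs u hu
    have := ((ENNReal.continuous_rpow_const (y := s)).tendsto 0).comp hu
    rwa [ENNReal.zero_rpow_of_pos hs] at this
  unfold mixedNorm
  refine hpow (by positivity) ?_
  have := tendsto_lintegral_of_dominated_convergence
    (F := fun n (t : ℝ) => ((∫⁻ x : Spc d, F n (t, x) ^ p) ^ (1 / p)) ^ q) (f := fun _ => 0)
    (μ := volume)
    (fun t => ((∫⁻ x : Spc d, G (t, x) ^ p) ^ (1 / p)) ^ q)
    (fun n => (measurable_inner_norm (hF n)).pow_const q) ?_ hG1 ?_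
  · simpa using this
  · refine fun n => Eventually.of_forall fun t => ?_
    dsimp only
    gcongr
    exact hFG n _
  · filter_upwards [hG2] with t ht
    refine hpow hq (hpow (by positivity) ?_)
    have := tendsto_lintegral_of_dominated_convergence
      (F := fun n (x : Spc d) => F n (t, x) ^ p) (f := fun _ => 0) (μ := volume)
      (fun x => G (t, x) ^ p)
      (fun n => ((hF n).comp measurable_prodMk_left).pow_const p) ?_ ht ?_
    · simpa using this
    · refine fun n => Eventually.of_forall fun x => ?_
      dsimp only
      gcongr
      exact hFG n _
    · exact Eventually.of_forall fun x => hpow hp (hlim _)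

theorem mixedNorm_indicator_prod_le_eLpNorm (hp : 0 < p) (hq : 0 < q) {r : ℝ} (hpr : p ≤ r)
    (hqr : q ≤ r) {I : Set ℝ} {B : Set (Spc d)} (hI : MeasurableSet I) (hB : MeasurableSet B)
    {h : SpT d → ℝ} (hh : Measurable h) :
    mixedNorm d p q ((I ×ˢ B).indicator fun z => ‖h z‖ₑ) ≤
      volume B ^ (1 / p - 1 / r) * volume I ^ (1 / q - 1 / r) *
        eLpNorm h (ENNReal.ofReal r) volume := by
  have hr : 0 < r := hp.trans_le hpr
  rw [mixedNorm_indicator_prod hp hq hI hB]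
  set J : ℝ → ℝ≥0∞ := fun t => (∫⁻ x in B, ‖h (t, x)‖ₑ ^ r) ^ (1 / r) with hJ
  have hJm : Measurable J :=
    Measurable.pow_const (Measurable.lintegral_prod_right'
      (f := fun z : SpT d => ‖h z‖ₑ ^ r) (hh.enorm.pow_const r)) _
  have h1 : ∀ t, (∫⁻ x in B, ‖h (t, x)‖ₑ ^ p) ^ (1 / p) ≤
      J t * volume B ^ (1 / p - 1 / r) := by
    intro t
    have := eLpNorm'_le_eLpNorm'_mul_rpow_measure_univ (μ := volume.restrict B)
      (f := fun x => h (t, x)) hp hpr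
      (hh.comp measurable_prodMk_left).aestronglyMeasurable
    simpa [eLpNorm', hJ] using this
  have h2 : (∫⁻ t in I, J t ^ q) ^ (1 / q) ≤
      (∫⁻ t in I, J t ^ r) ^ (1 / r) * volume I ^ (1 / q - 1 / r) := by
    have := eLpNorm'_le_eLpNorm'_mul_rpow_measure_univ (μ := volume.restrict I)
      (f := J) hq hqr hJm.aestronglyMeasurable
    simpa [eLpNorm'] using this
  have h3 : (∫⁻ t in I, J t ^ r) ^ (1 / r) ≤ eLpNorm h (ENNReal.ofReal r) volume := by
    rw [eLpNorm_eq_lintegral_rpow_enorm_toReal (by simpa using hr) ENNReal.ofReal_ne_top,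
      ENNReal.toReal_ofReal hr.le, Measure.volume_eq_prod,
      lintegral_prod _ (hh.enorm.pow_const r).aemeasurable]
    gcongr ?_ ^ _
    refine (setLIntegral_le_lintegral _ _).trans (lintegral_mono fun t => ?_)
    rw [hJ]
    dsimp only
    rw [← ENNReal.rpow_mul, one_div_mul_cancel hr.ne', ENNReal.rpow_one]
    exact setLIntegral_le_lintegral _ _
  calc (∫⁻ t in I, ((∫⁻ x in B, ‖h (t, x)‖ₑ ^ p) ^ (1 / p)) ^ q) ^ (1 / q)
      ≤ (∫⁻ t in I, (J t * volume B ^ (1 / p - 1 / r)) ^ q) ^ (1 / q) := by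
        gcongr with t
        exact h1 t
    _ = (∫⁻ t in I, J t ^ q) ^ (1 / q) * volume B ^ (1 / p - 1 / r) := by
        simp only [ENNReal.mul_rpow_of_nonneg _ _ hq.le]
        rw [lintegral_mul_const _ (hJm.pow_const q),
          ENNReal.mul_rpow_of_nonneg _ _ (by positivity), ← ENNReal.rpow_mul _ q,
          mul_one_div_cancel hq.ne', ENNReal.rpow_one]
    _ ≤ (eLpNorm h (ENNReal.ofReal r) volume * volume I ^ (1 / q - 1 / r)) *
          volume B ^ (1 / p - 1 / r) := by
        gcongr
        exact h2.trans (by gcongr)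
    _ = _ := by ring

theorem exists_continuous_mixedNorm_sub_le (hp : 1 < p) (hq : 1 < q) {f : SpT d → ℝ}
    (hf : Measurable f) {I : Set ℝ} {B : Set (Spc d)} (hI : MeasurableSet I)
    (hB : MeasurableSet B) (hI' : volume I ≠ ∞) (hB' : volume B ≠ ∞)
    (hfin : mixedNorm d p q ((I ×ˢ B).indicator fun z => ‖f z‖ₑ) ≠ ∞) {η : ℝ≥0∞} (hη : η ≠ 0) :
    ∃ φ : SpT d → ℝ, Continuous φ ∧ HasCompactSupport φ ∧
      mixedNorm d p q ((I ×ˢ B).indicator fun z => ‖f z - φ z‖ₑ) ≤ η := by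
  have hp0 : 0 < p := by linarith
  have hq0 : 0 < q := by linarith
  have hS : MeasurableSet (I ×ˢ B) := hI.prod hB
  set S := I ×ˢ B
  have hη2 : η / 2 ≠ 0 := by simpa using hη
  set g : ℕ → SpT d → ℝ := fun n => (S ∩ {z | ‖f z‖ ≤ n}).indicator f with hg
  have hgS : ∀ n : ℕ, MeasurableSet (S ∩ {z | ‖f z‖ ≤ (n : ℝ)}) := fun n : ℕ =>
    hS.inter (measurableSet_le hf.norm measurable_const)
  have hgm : ∀ n, Measurable (g n) := fun n => hf.indicator (hgS n)
  have hlim : Tendsto (fun n => mixedNorm d p q (S.indicator fun z => ‖f z - g n z‖ₑ))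
      atTop (𝓝 0) := by
    refine tendsto_mixedNorm_of_dominated hp0 hq0
      (fun n => (hf.sub (hgm n)).enorm.indicator hS) (hf.enorm.indicator hS) ?_ hfin ?_
    · intro n z
      refine indicator_le_indicator ?_
      by_cases h : z ∈ S ∩ {z | ‖f z‖ ≤ n}
      · simp only [hg, indicator_of_mem h, sub_self, enorm_zero, zero_le]
      · simp only [hg, indicator_of_notMem h, sub_zero, le_rfl]
    · intro z
      obtain ⟨m, hm⟩ := exists_nat_ge ‖f z‖
      refine tendsto_const_nhds.congr' ?_
      filter_upwards [eventually_ge_atTop m] with n hn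
      by_cases h : z ∈ S
      · have : z ∈ S ∩ {z | ‖f z‖ ≤ n} := ⟨h, hm.trans (by exact_mod_cast hn)⟩
        simp only [hg, indicator_of_mem h, indicator_of_mem this, sub_self, enorm_zero]
      · rw [indicator_of_notMem h]
  obtain ⟨n, hn⟩ := (hlim.eventually (ge_mem_nhds (pos_iff_ne_zero.2 hη2))).exists
  set r := max p q
  have hr : 1 < r := lt_max_of_lt_left hp
  set c := volume B ^ (1 / p - 1 / r) * volume I ^ (1 / q - 1 / r)
  have hc : c ≠ ∞ := by
    refine ENNReal.mul_ne_top (ENNReal.rpow_ne_top_of_nonneg ?_ hB')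
      (ENNReal.rpow_ne_top_of_nonneg ?_ hI')
    · exact sub_nonneg.2 (one_div_le_one_div_of_le hp0 (le_max_left _ _))
    · exact sub_nonneg.2 (one_div_le_one_div_of_le hq0 (le_max_right _ _))
  have hmem : MemLp (g n) (ENNReal.ofReal r) volume := by
    have hSv : volume S ≠ ∞ := by
      rw [Measure.volume_eq_prod, Measure.prod_prod]
      exact ENNReal.mul_ne_top hI' hB'
    have h1 : MemLp (S.indicator fun _ => (n : ℝ)) (ENNReal.ofReal r) volume :=
      memLp_indicator_const _ hS _ (Or.inr hSv)
    refine h1.mono' (hgm n).aestronglyMeasurable (Eventually.of_forall fun z => ?_)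
    by_cases h : z ∈ S ∩ {z | ‖f z‖ ≤ n}
    · simp only [hg, indicator_of_mem h, indicator_of_mem h.1]
      exact h.2
    · simp only [hg, indicator_of_notMem h, norm_zero]
      exact indicator_nonneg (fun _ _ => by positivity) _
  have hηc : η / 2 / (c + 1) ≠ 0 := by
    simp [hη, hc]
  obtain ⟨φ, hφs, hφ, hφc, -⟩ :=
    hmem.exists_hasCompactSupport_eLpNorm_sub_le ENNReal.ofReal_ne_top hηc
  refine ⟨φ, hφc, hφs, ?_⟩
  have h2 : mixedNorm d p q (S.indicator fun z => ‖g n z - φ z‖ₑ) ≤ η / 2 := by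
    refine (mixedNorm_indicator_prod_le_eLpNorm hp0 hq0 (le_max_left p q) (le_max_right p q) hI hB
      ((hgm n).sub hφc.measurable)).trans ?_
    calc c * eLpNorm (g n - φ) (ENNReal.ofReal r) volume
        ≤ (c + 1) * (η / 2 / (c + 1)) := by
          gcongr
          exact le_self_add
      _ ≤ η / 2 := ENNReal.mul_div_le
  calc mixedNorm d p q (S.indicator fun z => ‖f z - φ z‖ₑ)
      ≤ mixedNorm d p q (fun z => S.indicator (fun z => ‖f z - g n z‖ₑ) z +
          S.indicator (fun z => ‖g n z - φ z‖ₑ) z) := by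
        refine mixedNorm_mono hp0 hq0 fun z => ?_
        by_cases h : z ∈ S
        · simp only [indicator_of_mem h]
          rw [← sub_add_sub_cancel (f z) (g n z) (φ z)]
          exact enorm_add_le _ _
        · simp [h]
    _ ≤ η / 2 + η / 2 := (mixedNorm_add_le hp.le hq.le ((hf.sub (hgm n)).enorm.indicator hS)
          (((hgm n).sub hφc.measurable).enorm.indicator hS)).trans (add_le_add hn h2)
    _ = η := ENNReal.add_halves η

/-- Continuity of translations in `L_{p,q}` over a parabolic cylinder. -/
theorem eventually_mixedNorm_translate_sub_le (hp : 1 < p) (hq : 1 < q) {f : SpT d → ℝ}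
    (hf : Measurable f)
    (hfin : ∀ K : Set (SpT d), IsCompact K →
      mixedNorm d p q (K.indicator fun z => ‖f z‖ₑ) ≠ ∞)
    (R t₀ : ℝ) (x₀ : Spc d) {η : ℝ≥0∞} (hη : η ≠ 0) :
    ∀ᶠ w : SpT d in 𝓝 0,
      mixedNorm d p q ((pCyl d R t₀ x₀).indicator fun z => ‖f (z - w) - f z‖ₑ) ≤ η := by
  have hp0 : 0 < p := by linarith
  have hq0 : 0 < q := by linarith
  have hη3 : η / 3 ≠ 0 := by simpa using hη
  set I : Set ℝ := Icc (t₀ - 1) (t₀ + R ^ 2 + 1)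
  set B : Set (Spc d) := closedBall x₀ (R + 1)
  set C := pCyl d R t₀ x₀ with hC
  have hCm : MeasurableSet C := measurableSet_pCyl _ _ _
  have hKm : MeasurableSet (I ×ˢ B) := measurableSet_Icc.prod measurableSet_closedBall
  obtain ⟨φ, hφc, hφs, hφ⟩ := exists_continuous_mixedNorm_sub_le hp hq hf (I := I) (B := B)
    measurableSet_Icc measurableSet_closedBall isCompact_Icc.measure_lt_top.ne
    (isCompact_closedBall x₀ (R + 1)).measure_lt_top.ne
    (hfin _ (isCompact_Icc.prod (isCompact_closedBall x₀ (R + 1)))) hη3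
  have hsub : ∀ w : SpT d, ‖w‖ < 1 → ∀ z ∈ C, z - w ∈ I ×ˢ B := by
    rintro ⟨s, y⟩ hw ⟨t, x⟩ ⟨ht, hx⟩
    have hs : |s| < 1 := (norm_fst_le _).trans_lt hw
    have hy : ‖y‖ < 1 := (norm_snd_le _).trans_lt hw
    rw [abs_lt] at hs
    simp only [mem_Ico, mem_ball, dist_eq_norm] at ht hx
    refine ⟨⟨?_, ?_⟩, ?_⟩
    · simp only [Prod.fst_sub]; linarith
    · simp only [Prod.fst_sub]; linarith
    · simp only [Prod.snd_sub, B, mem_closedBall, dist_eq_norm]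
      calc ‖x - y - x₀‖ = ‖(x - x₀) - y‖ := by congr 1; abel
        _ ≤ ‖x - x₀‖ + ‖y‖ := norm_sub_le _ _
        _ ≤ R + 1 := by linarith
  have hCK : C ⊆ I ×ˢ B := fun z hz => by simpa using hsub 0 (by simp) z hz
  set m := mixedNorm d p q (C.indicator fun _ => 1) with hm
  have hmtop : m ≠ ∞ := by
    rw [hm, hC]
    unfold pCyl
    rw [mixedNorm_indicator_prod hp0 hq0 measurableSet_Ico measurableSet_ball]
    simp only [ENNReal.one_rpow, lintegral_const, one_mul, Measure.restrict_apply_univ]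
    refine ENNReal.rpow_ne_top_of_nonneg (by positivity) (ENNReal.mul_ne_top ?_ (by simp))
    exact ENNReal.rpow_ne_top_of_nonneg hq0.le
      (ENNReal.rpow_ne_top_of_nonneg (by positivity) measure_ball_lt_top.ne)
  have hconst : ∀ a : ℝ≥0∞, a ≠ ∞ → mixedNorm d p q (C.indicator fun _ => a) = a * m := by
    intro a ha
    rw [hm, hC]
    unfold pCyl
    rw [mixedNorm_indicator_prod hp0 hq0 measurableSet_Ico measurableSet_ball,
      mixedNorm_indicator_prod hp0 hq0 measurableSet_Ico measurableSet_ball]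
    simp only [ENNReal.one_rpow, lintegral_const, one_mul, Measure.restrict_apply_univ,
      ENNReal.mul_rpow_of_nonneg _ _ hq0.le,
      ENNReal.mul_rpow_of_nonneg _ _ (one_div_nonneg.2 hp0.le),
      ENNReal.mul_rpow_of_nonneg _ _ (one_div_nonneg.2 hq0.le)]
    simp only [← ENNReal.rpow_mul]
    rw [show p * (1 / p) * q * (1 / q) = 1 by field_simp, ENNReal.rpow_one]
    ring
  obtain ⟨s, hs0, hsm⟩ : ∃ s : ℝ, 0 < s ∧ ENNReal.ofReal s * m ≤ η / 3 := by
    have h0 : Tendsto (fun s : ℝ => ENNReal.ofReal s * m) (𝓝[>] 0) (𝓝 0) := by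
      have : Tendsto (fun s : ℝ => ENNReal.ofReal s * m) (𝓝 0) (𝓝 (ENNReal.ofReal 0 * m)) :=
        ENNReal.Tendsto.mul_const (ENNReal.continuous_ofReal.tendsto 0) (Or.inr hmtop)
      simpa using this.mono_left nhdsWithin_le_nhds
    obtain ⟨s, h1, h2⟩ := ((h0.eventually (ge_mem_nhds (pos_iff_ne_zero.2 hη3))).and
      self_mem_nhdsWithin).exists
    exact ⟨s, h2, h1⟩
  have huc : UniformContinuous φ := hφs.uniformContinuous_of_continuous hφc
  obtain ⟨δ, hδ, hδφ⟩ := Metric.uniformContinuous_iff.1 huc s hs0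
  filter_upwards [ball_mem_nhds (0 : SpT d) one_pos, ball_mem_nhds (0 : SpT d) hδ] with w hw1 hwδ
  rw [mem_ball_zero_iff] at hw1 hwδ
  set e : SpT d → ℝ≥0∞ := (I ×ˢ B).indicator fun z => ‖f z - φ z‖ₑ with he
  have hem : Measurable e := (hf.sub hφc.measurable).enorm.indicator hKm
  have hpt : ∀ z, C.indicator (fun z => ‖f (z - w) - f z‖ₑ) z ≤
      (e (z - w) + e z) + C.indicator (fun _ => ENNReal.ofReal s) z := by
    intro z
    by_cases hz : z ∈ C
    · simp only [he, indicator_of_mem hz, indicator_of_mem (hCK hz),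
        indicator_of_mem (hsub w hw1 z hz)]
      have h1 : ‖φ (z - w) - φ z‖ₑ ≤ ENNReal.ofReal s := by
        rw [← ofReal_norm]
        refine ENNReal.ofReal_le_ofReal ?_
        rw [← dist_eq_norm]
        refine (hδφ ?_).le
        simpa [dist_eq_norm] using hwδ
      calc ‖f (z - w) - f z‖ₑ
          = ‖(f (z - w) - φ (z - w)) - (f z - φ z) + (φ (z - w) - φ z)‖ₑ := by congr 1; ring
        _ ≤ ‖(f (z - w) - φ (z - w)) - (f z - φ z)‖ₑ + ‖φ (z - w) - φ z‖ₑ := enorm_add_le _ _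
        _ ≤ _ := add_le_add enorm_sub_le h1
    · simp [hz]
  have hemw : Measurable fun z => e (z - w) := hem.comp (measurable_sub_const w)
  refine (mixedNorm_mono hp0 hq0 hpt).trans ?_
  refine (mixedNorm_add_le hp.le hq.le (hemw.add hem)
    (measurable_const.indicator hCm)).trans ?_
  rw [hconst _ ENNReal.ofReal_ne_top]
  refine (add_le_add (mixedNorm_add_le hp.le hq.le hemw hem) hsm).trans ?_
  rw [mixedNorm_translate]
  refine (add_le_add (add_le_add hφ hφ) le_rfl).trans (le_of_eq (ENNReal.add_thirds η))

end Approximation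

section Mollification

variable {d : ℕ} {p q : ℝ} {ζ : SpT d → ℝ}

/-- The rescaled kernel `ζ_ε`. -/
def scaledKernel (d : ℕ) (ζ : SpT d → ℝ) (ε : ℝ) (w : SpT d) : ℝ :=
  ε ^ (-(d : ℝ) - 2) * ζ (w.1 / ε ^ 2, ε⁻¹ • w.2)

/-- The measure with density `ζ_ε`. -/
def kernelMeasure (d : ℕ) (ζ : SpT d → ℝ) (ε : ℝ) : Measure (SpT d) :=
  volume.withDensity fun w => ENNReal.ofReal (scaledKernel d ζ ε w)

theorem IsMollifier.continuous_rescale (hζ : IsMollifier d ζ) (ε : ℝ) :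
    Continuous fun w : SpT d => ζ (w.1 / ε ^ 2, ε⁻¹ • w.2) :=
  hζ.1.continuous.comp (by fun_prop)

theorem IsMollifier.continuous_scaledKernel (hζ : IsMollifier d ζ) (ε : ℝ) :
    Continuous (scaledKernel d ζ ε) :=
  continuous_const.mul (hζ.continuous_rescale ε)

theorem IsMollifier.scaledKernel_nonneg (hζ : IsMollifier d ζ) {ε : ℝ} (hε : 0 < ε) (w : SpT d) :
    0 ≤ scaledKernel d ζ ε w :=
  mul_nonneg (by positivity) (hζ.2.1 _)

theorem IsMollifier.support_rescale_subset (hζ : IsMollifier d ζ) {ε : ℝ} (hε : 0 < ε) :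
    Function.support (fun w : SpT d => ζ (w.1 / ε ^ 2, ε⁻¹ • w.2)) ⊆
      Icc (-ε ^ 2) 0 ×ˢ closedBall (0 : Spc d) ε := by
  intro w hw
  obtain ⟨⟨h1, h2⟩, h3⟩ := hζ.2.2.2 (show (w.1 / ε ^ 2, ε⁻¹ • w.2) ∈ Function.support ζ from hw)
  have hε2 : 0 < ε ^ 2 := by positivity
  refine ⟨⟨?_, ?_⟩, ?_⟩
  · rw [le_div_iff₀ hε2] at h1; linarith
  · rw [div_lt_iff₀ hε2] at h2; linarith
  · simp only [mem_ball_zero_iff, norm_smul, norm_inv, Real.norm_eq_abs, abs_of_pos hε] at h3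
    rw [inv_mul_lt_iff₀ hε, mul_one] at h3
    simpa using h3.le

theorem IsMollifier.integrable_rescale (hζ : IsMollifier d ζ) {ε : ℝ} (hε : 0 < ε) :
    Integrable (fun w : SpT d => ζ (w.1 / ε ^ 2, ε⁻¹ • w.2)) :=
  (hζ.continuous_rescale ε).integrable_of_hasCompactSupport
    (HasCompactSupport.of_support_subset_isCompact
      (isCompact_Icc.prod (isCompact_closedBall _ _)) (hζ.support_rescale_subset hε))

theorem IsMollifier.integral_scaledKernel (hζ : IsMollifier d ζ) {ε : ℝ} (hε : 0 < ε) :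
    ∫ w, scaledKernel d ζ ε w = 1 := by
  have hζi : Integrable ζ := by simpa using hζ.integrable_rescale one_pos
  unfold scaledKernel
  rw [integral_const_mul, Measure.volume_eq_prod, integral_prod _ (hζ.integrable_rescale hε)]
  have h1 : ∀ t : ℝ, ∫ x : Spc d, ζ (t / ε ^ 2, ε⁻¹ • x) = ε ^ d * ∫ x : Spc d, ζ (t / ε ^ 2, x) := by
    intro t
    rw [Measure.integral_comp_smul volume (fun x : Spc d => ζ (t / ε ^ 2, x)) ε⁻¹]
    simp [abs_of_pos hε]
  simp only [h1]
  rw [integral_const_mul, Measure.integral_comp_div (fun t => ∫ x : Spc d, ζ (t, x)) (ε ^ 2),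
    ← integral_prod _ hζi, ← Measure.volume_eq_prod, hζ.2.2.1, smul_eq_mul, mul_one,
    abs_of_pos (by positivity), ← Real.rpow_natCast ε d, ← Real.rpow_natCast ε 2,
    ← Real.rpow_add hε, ← Real.rpow_add hε]
  simp

theorem IsMollifier.isProbabilityMeasure_kernelMeasure (hζ : IsMollifier d ζ) {ε : ℝ}
    (hε : 0 < ε) : IsProbabilityMeasure (kernelMeasure d ζ ε) := by
  constructor
  rw [kernelMeasure, withDensity_apply _ MeasurableSet.univ, Measure.restrict_univ,
    ← ofReal_integral_eq_lintegral_ofReal, hζ.integral_scaledKernel hε, ENNReal.ofReal_one]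
  · exact (hζ.integrable_rescale hε).const_mul _
  · exact Eventually.of_forall (hζ.scaledKernel_nonneg hε)

theorem IsMollifier.eventually_ae_mem (hζ : IsMollifier d ζ) {U : Set (SpT d)} (hU : U ∈ 𝓝 0) :
    ∀ᶠ ε in 𝓝[>] (0 : ℝ), ∀ᵐ w ∂kernelMeasure d ζ ε, w ∈ U := by
  obtain ⟨r, hr, hrU⟩ := Metric.mem_nhds_iff.1 hU
  filter_upwards [Ioo_mem_nhdsGT (show 0 < min r 1 from lt_min hr one_pos)] with ε hε
  have hε0 := hε.1
  have hεr := hε.2.trans_le (min_le_left _ _)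
  have hε1 := hε.2.trans_le (min_le_right _ _)
  rw [kernelMeasure, ae_withDensity_iff
    (hζ.continuous_scaledKernel ε).measurable.ennreal_ofReal]
  refine Eventually.of_forall fun w hw => hrU ?_
  have hw' : ζ (w.1 / ε ^ 2, ε⁻¹ • w.2) ≠ 0 := fun h => hw (by simp [scaledKernel, h])
  obtain ⟨⟨h1, h2⟩, h3⟩ := hζ.support_rescale_subset hε0 hw'
  rw [mem_closedBall_zero_iff] at h3
  rw [mem_ball_zero_iff, Prod.norm_def]
  refine max_lt ?_ (h3.trans_lt hεr)
  rw [Real.norm_eq_abs, abs_lt]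
  constructor <;> nlinarith

theorem IsMollifier.enorm_mollify_sub_le (hζ : IsMollifier d ζ) {ε : ℝ} (hε : 0 < ε)
    {f : SpT d → ℝ} (hf : Measurable f) (z : SpT d) :
    ‖mollify d ζ ε f z - f z‖ₑ ≤ ∫⁻ w, ‖f (z - w) - f z‖ₑ ∂kernelMeasure d ζ ε := by
  have := hζ.isProbabilityMeasure_kernelMeasure hε
  have h1 : mollify d ζ ε f z = ∫ w, f (z - w) ∂kernelMeasure d ζ ε := by
    rw [kernelMeasure, integral_withDensity_eq_integral_toReal_smul
      (hζ.continuous_scaledKernel ε).measurable.ennreal_ofReal (by simp)]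
    unfold mollify
    refine integral_congr_ae (Eventually.of_forall fun w => ?_)
    simp only [ENNReal.toReal_ofReal (hζ.scaledKernel_nonneg hε w), smul_eq_mul]
    rfl
  have hm : Measurable fun w => f (z - w) := hf.comp (measurable_const_sub z)
  by_cases hi : Integrable (fun w => f (z - w)) (kernelMeasure d ζ ε)
  · have h2 : mollify d ζ ε f z - f z = ∫ w, (f (z - w) - f z) ∂kernelMeasure d ζ ε := by
      rw [integral_sub hi (integrable_const _), h1]
      simp
    rw [h2]
    exact enorm_integral_le_lintegral_enorm _
  · have h2 : ∫⁻ w, ‖f (z - w) - f z‖ₑ ∂kernelMeasure d ζ ε = ∞ := by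
      by_contra h
      refine hi ?_
      have h3 : Integrable (fun w => f (z - w) - f z) (kernelMeasure d ζ ε) :=
        ⟨(hm.sub_const _).aestronglyMeasurable, lt_top_iff_ne_top.2 h⟩
      refine (h3.add (integrable_const (f z))).congr (Eventually.of_forall fun w => ?_)
      simp
    rw [h2]
    exact le_top

theorem mollify_congr_ae {f g : SpT d → ℝ} (h : f =ᵐ[volume] g) (ε : ℝ) (z : SpT d) :
    mollify d ζ ε f z = mollify d ζ ε g z := by
  unfold mollify
  refine integral_congr_ae ?_
  have : (volume : Measure (SpT d)).IsAddLeftInvariant :=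
    inferInstanceAs ((volume : Measure ℝ).prod (volume : Measure (Spc d))).IsAddLeftInvariant
  have h2 : ∀ᵐ w : SpT d, f (z - w) = g (z - w) :=
    (quasiMeasurePreserving_sub_left volume z).ae h
  filter_upwards [h2] with w hw
  have : f (z.1 - w.1, z.2 - w.2) = g (z.1 - w.1, z.2 - w.2) := hw
  rw [this]

theorem IsMollifier.morreyNorm_indicator_mollify_sub_le (hζ : IsMollifier d ζ) (hp : 1 < p)
    (hq : 1 < q) (β : ℝ) {f : SpT d → ℝ} (hf : Measurable f) {C : Set (SpT d)}
    (hC : MeasurableSet C) {U : Set (SpT d)} {A : ℝ≥0∞}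
    (hA : ∀ w ∈ U, morreyNorm d p q β (C.indicator fun z => f (z - w) - f z) ≤ A)
    {ε : ℝ} (hε : 0 < ε) (hU : ∀ᵐ w ∂kernelMeasure d ζ ε, w ∈ U) :
    morreyNorm d p q β (C.indicator fun z => mollify d ζ ε f z - f z) ≤ A := by
  have hp0 : 0 < p := by linarith
  have hq0 : 0 < q := by linarith
  have := hζ.isProbabilityMeasure_kernelMeasure hε
  refine morreyNorm_le hp0 hq0 fun ρ hρ hρ1 t₀ x₀ => ?_
  set D := pCyl d ρ t₀ x₀
  have hD : MeasurableSet D := measurableSet_pCyl _ _ _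
  set K : SpT d → SpT d → ℝ≥0∞ := fun z w =>
    D.indicator (fun z => ‖C.indicator (fun z => f (z - w) - f z) z‖ₑ) z with hK
  have hKm : Measurable (Function.uncurry K) := by
    have h1 : Measurable fun u : SpT d × SpT d => ‖f (u.1 - u.2) - f u.1‖ₑ :=
      ((hf.comp (measurable_fst.sub measurable_snd)).sub (hf.comp measurable_fst)).enorm
    have h2 : Function.uncurry K =
        ((D ∩ C) ×ˢ univ).indicator fun u : SpT d × SpT d => ‖f (u.1 - u.2) - f u.1‖ₑ := by
      ext ⟨z, w⟩
      by_cases hz : z ∈ D <;> by_cases hz' : z ∈ C <;> simp [hK, Function.uncurry, hz, hz']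
    rw [h2]
    exact h1.indicator ((hD.inter hC).prod MeasurableSet.univ)
  have hle : mixedNorm d p q (D.indicator fun z =>
      ‖C.indicator (fun z => mollify d ζ ε f z - f z) z‖ₑ) ≤
      ∫⁻ w, mixedNorm d p q (fun z => K z w) ∂kernelMeasure d ζ ε := by
    refine le_trans (mixedNorm_mono hp0 hq0 fun z => ?_)
      (mixedNorm_lintegral_le (kernelMeasure d ζ ε) hp hq hKm)
    by_cases hz : z ∈ D <;> by_cases hz' : z ∈ C <;>
      simp [hK, hz, hz', hζ.enorm_mollify_sub_le hε hf z]
  calc ENNReal.ofReal (ρ ^ β) * (cylConst d p q ρ * mixedNorm d p q (D.indicator fun z =>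
          ‖C.indicator (fun z => mollify d ζ ε f z - f z) z‖ₑ))
      ≤ ENNReal.ofReal (ρ ^ β) * (cylConst d p q ρ *
          ∫⁻ w, mixedNorm d p q (fun z => K z w) ∂kernelMeasure d ζ ε) := by gcongr
    _ = ∫⁻ w, ENNReal.ofReal (ρ ^ β) * (cylConst d p q ρ *
          mixedNorm d p q (fun z => K z w)) ∂kernelMeasure d ζ ε := by
        rw [lintegral_const_mul' _ _ ENNReal.ofReal_ne_top,
          lintegral_const_mul' _ _ (cylConst_ne_top hp0 hq0 hρ)]
    _ ≤ ∫⁻ _, A ∂kernelMeasure d ζ ε := by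
        refine lintegral_mono_ae ?_
        filter_upwards [hU] with w hw
        exact (le_morreyNorm hp0 hq0 β _ hρ hρ1 t₀ x₀).trans (hA w hw)
    _ = A := by simp

theorem cylConst_mul_mixedNorm_translate_le (hp : 0 < p) (hq : 0 < q) (β : ℝ) (f : SpT d → ℝ)
    {ρ : ℝ} (hρ : 0 < ρ) (hρ1 : ρ ≤ 1) (t₀ : ℝ) (x₀ : Spc d) (w : SpT d) :
    ENNReal.ofReal (ρ ^ β) * (cylConst d p q ρ *
      mixedNorm d p q ((pCyl d ρ t₀ x₀).indicator fun z => ‖f (z - w)‖ₑ)) ≤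
      morreyNorm d p q β f := by
  refine le_trans (le_of_eq ?_) (le_morreyNorm hp hq β f hρ hρ1 (t₀ - w.1) (x₀ - w.2))
  congr 2
  rw [← mixedNorm_translate ((pCyl d ρ (t₀ - w.1) (x₀ - w.2)).indicator _) w]
  congr 1
  ext z
  have : z ∈ pCyl d ρ t₀ x₀ ↔ z - w ∈ pCyl d ρ (t₀ - w.1) (x₀ - w.2) := by
    simp only [pCyl, mem_prod, mem_Ico, mem_ball, Prod.fst_sub, Prod.snd_sub, dist_sub_right]
    constructor <;> rintro ⟨⟨h1, h2⟩, h3⟩ <;> exact ⟨⟨by linarith, by linarith⟩, h3⟩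
  by_cases hz : z ∈ pCyl d ρ t₀ x₀
  · rw [indicator_of_mem hz, indicator_of_mem (this.1 hz)]
  · rw [indicator_of_notMem hz, indicator_of_notMem (fun h => hz (this.2 h))]

/-- Local continuity of translations from `E_{p,q,β'}` to `E_{p,q,β}`, `β' < β`. -/
theorem eventually_morreyNorm_translate_sub_le (hp : 1 < p) (hq : 1 < q) {β β' : ℝ}
    (hβ0 : 0 ≤ β) (hβ : β' < β) {f : SpT d → ℝ} (hf : Measurable f)
    (hfin : morreyNorm d p q β' f ≠ ∞) (R t₀ : ℝ) (x₀ : Spc d) {η : ℝ≥0∞} (hη : η ≠ 0) :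
    ∀ᶠ w : SpT d in 𝓝 0,
      morreyNorm d p q β ((pCyl d R t₀ x₀).indicator fun z => f (z - w) - f z) ≤ η := by
  have hp0 : 0 < p := by linarith
  have hq0 : 0 < q := by linarith
  set N := morreyNorm d p q β' f
  obtain ⟨δ, hδ, hδN⟩ : ∃ δ : ℝ, 0 < δ ∧ ENNReal.ofReal (δ ^ (β - β')) * (N + N) ≤ η := by
    have h0 : Tendsto (fun δ : ℝ => ENNReal.ofReal (δ ^ (β - β')) * (N + N)) (𝓝[>] 0) (𝓝 0) := by
      have h1 : Tendsto (fun δ : ℝ => δ ^ (β - β')) (𝓝 0) (𝓝 0) := by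
        have := (Real.continuousAt_rpow_const 0 (β - β') (Or.inr (sub_pos.2 hβ).le)).tendsto
        rwa [Real.zero_rpow (sub_pos.2 hβ).ne'] at this
      have := ENNReal.Tendsto.mul_const ((ENNReal.continuous_ofReal.tendsto 0).comp h1)
        (Or.inr (ENNReal.add_ne_top.2 ⟨hfin, hfin⟩))
      simpa using this.mono_left nhdsWithin_le_nhds
    obtain ⟨s, h1, h2⟩ := ((h0.eventually (ge_mem_nhds (pos_iff_ne_zero.2 hη))).and
      self_mem_nhdsWithin).exists
    exact ⟨s, h2, h1⟩
  have hc0 := cylConst_ne_zero (d := d) hp0 hq0 (ρ := δ)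
  have hct := cylConst_ne_top (d := d) hp0 hq0 hδ
  have hηc : η / cylConst d p q δ ≠ 0 := by simp [hη, hct]
  filter_upwards [eventually_mixedNorm_translate_sub_le hp hq hf
    (fun K hK => mixedNorm_indicator_ne_top_of_isCompact hp hq hf hfin hK) R t₀ x₀ hηc] with w hw
  refine morreyNorm_le hp0 hq0 fun ρ hρ hρ1 s y => ?_
  set C := pCyl d R t₀ x₀
  set D := pCyl d ρ s y
  have hD : MeasurableSet D := measurableSet_pCyl _ _ _
  rcases le_total ρ δ with h | h
  · have hfw : Measurable fun z => f (z - w) := hf.comp (measurable_sub_const w)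
    have h1 : mixedNorm d p q (D.indicator fun z => ‖C.indicator (fun z => f (z - w) - f z) z‖ₑ) ≤
        mixedNorm d p q (D.indicator fun z => ‖f (z - w)‖ₑ) +
          mixedNorm d p q (D.indicator fun z => ‖f z‖ₑ) := by
      refine (mixedNorm_mono hp0 hq0 fun z => ?_).trans
        (mixedNorm_add_le hp.le hq.le (hfw.enorm.indicator hD) (hf.enorm.indicator hD))
      by_cases hz : z ∈ D <;> by_cases hz' : z ∈ C <;> simp [hz, hz', enorm_sub_le]
    calc _ ≤ ENNReal.ofReal (ρ ^ β) * (cylConst d p q ρ *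
            (mixedNorm d p q (D.indicator fun z => ‖f (z - w)‖ₑ) +
              mixedNorm d p q (D.indicator fun z => ‖f z‖ₑ))) := by gcongr
      _ = ENNReal.ofReal (ρ ^ (β - β')) *
            (ENNReal.ofReal (ρ ^ β') * (cylConst d p q ρ *
              mixedNorm d p q (D.indicator fun z => ‖f (z - w)‖ₑ)) +
            ENNReal.ofReal (ρ ^ β') * (cylConst d p q ρ *
              mixedNorm d p q (D.indicator fun z => ‖f z‖ₑ))) := by
          have : ρ ^ β = ρ ^ (β - β') * ρ ^ β' := by
            rw [← Real.rpow_add hρ, sub_add_cancel]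
          rw [this, ENNReal.ofReal_mul (by positivity)]
          ring
      _ ≤ ENNReal.ofReal (δ ^ (β - β')) * (N + N) := by
          gcongr
          · exact cylConst_mul_mixedNorm_translate_le hp0 hq0 β' f hρ hρ1 s y w
          · exact le_morreyNorm hp0 hq0 β' f hρ hρ1 s y
      _ ≤ η := hδN
  · have h1 : mixedNorm d p q (D.indicator fun z => ‖C.indicator (fun z => f (z - w) - f z) z‖ₑ) ≤
        η / cylConst d p q δ := by
      refine (mixedNorm_mono hp0 hq0 fun z => ?_).trans hw
      by_cases hz : z ∈ D <;> by_cases hz' : z ∈ C <;> simp [hz, hz']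
    calc _ ≤ 1 * (cylConst d p q δ * (η / cylConst d p q δ)) := by
          gcongr
          · exact ENNReal.ofReal_le_one.2 (Real.rpow_le_one hρ.le hρ1 hβ0)
          · exact cylConst_anti hp0 hq0 hδ h
      _ = η := by rw [one_mul, ENNReal.mul_div_cancel hc0 hct]

end Mollification

/-- Lemma 2.3 of [2]: if `f ∈ E_{p,q,β'}` with `0 ≤ β' < β`, then
    for every parabolic cylinder `C = C_R(t₀,x₀)`,
    `‖(f^{(ε)} - f)·1_C‖_{E_{p,q,β}} → 0` as `ε ↓ 0`. -/
theorem statement0 (d : ℕ) (hd : 1 ≤ d) (p q β β' : ℝ)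
    (hp : 1 < p) (hq : 1 < q) (hβ'0 : 0 ≤ β') (hβ' : β' < β)
    (ζ : SpT d → ℝ) (hζ : IsMollifier d ζ)
    (f : SpT d → ℝ) (hf : MemE d p q β' f)
    (R t₀ : ℝ) (hR : 0 < R) (x₀ : Spc d) :
    Tendsto (fun ε : ℝ =>
        morreyNorm d p q β ((pCyl d R t₀ x₀).indicator (fun z => mollify d ζ ε f z - f z)))
      (𝓝[>] (0 : ℝ)) (𝓝 0) := by
  have hp0 : 0 < p := by linarith
  have hq0 : 0 < q := by linarith
  obtain ⟨hfm, hfin⟩ := hf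
  set g := hfm.mk f
  have hg : Measurable g := hfm.stronglyMeasurable_mk.measurable
  have hfg : f =ᵐ[volume] g := hfm.ae_eq_mk
  rw [morreyNorm_congr_ae hp0 hq0 hfg] at hfin
  have hcongr : ∀ ε, morreyNorm d p q β
      ((pCyl d R t₀ x₀).indicator (fun z => mollify d ζ ε f z - f z)) =
      morreyNorm d p q β ((pCyl d R t₀ x₀).indicator (fun z => mollify d ζ ε g z - g z)) := by
    intro ε
    refine morreyNorm_congr_ae hp0 hq0 ?_
    filter_upwards [hfg] with z hz
    simp only [indicator, mollify_congr_ae hfg, hz]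
  simp only [hcongr]
  refine ENNReal.tendsto_nhds_zero.2 fun η hη => ?_
  have hU := eventually_morreyNorm_translate_sub_le hp hq (hβ'0.trans hβ'.le) hβ' hg hfin R t₀ x₀
    hη.ne'
  filter_upwards [self_mem_nhdsWithin, hζ.eventually_ae_mem hU] with ε hε hεU
  exact hζ.morreyNorm_indicator_mollify_sub_le hp hq β hg (measurableSet_pCyl _ _ _)
    (fun w hw => hw) hε hεU
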